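/- arXiv:0707.1496 — 2 statements merged into one kernel-verified Lean document; each statement's English description precedes it below -/
import Mathlib

section
/- Let p be a prime, let n ≥ 1, let 0 ≤ k ≤ n, and let B be a finite set of nonzero vectors of 𝔽_pⁿ satisfying |B| · (p^k − 1) < pⁿ − 1. Then there exists a k-dimensional 𝔽_p-linear subspace V of 𝔽_pⁿ with V ∩ B = ∅. -/
/-- If the union of `V` and the sets `V + Kˣ • b` for `b ∈ B` is too small to cover the space
and `V` avoids `B`, then some subspace of one dimension more avoids `B`. -/
theorem exists_finrank_succ_avoiding {K E : Type*} [Field K] [Fintype K] [AddCommGroup E]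
    [Module K E] [Fintype E] (B : Finset E) (V : Submodule K E) (hV : ∀ b ∈ B, b ∉ V)
    (hcard : B.card * (Fintype.card K ^ Module.finrank K V * (Fintype.card K - 1)) +
      Fintype.card K ^ Module.finrank K V < Fintype.card E) :
    ∃ W : Submodule K E, Module.finrank K W = Module.finrank K V + 1 ∧ ∀ b ∈ B, b ∉ W := by
  classical
  have hcardV : Fintype.card V = Fintype.card K ^ Module.finrank K V :=
    Module.card_eq_pow_finrank
  let translates : Finset E := (B ×ˢ (Finset.univ : Finset (V × Kˣ))).image
    fun t => (t.2.1 : E) + t.2.2 • t.1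
  let points : Finset E := Finset.univ.image (fun v : V => (v : E))
  obtain ⟨x, hx⟩ : ∃ x, x ∉ translates ∪ points := by
    by_contra! h
    have huniv : translates ∪ points = Finset.univ := Finset.eq_univ_of_forall h
    have h1 : translates.card ≤ B.card * (Fintype.card V * (Fintype.card K - 1)) := by
      refine Finset.card_image_le.trans_eq ?_
      rw [Finset.card_product, Finset.card_univ, Fintype.card_prod, Fintype.card_units]
    have h2 : points.card ≤ Fintype.card V := Finset.card_image_le
    have h3 := Finset.card_union_le translates points
    rw [huniv, Finset.card_univ] at h3
    rw [← hcardV] at hcard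
    lia
  rw [Finset.mem_union, not_or] at hx
  have hxV : x ∉ V := fun h => hx.2 (Finset.mem_image.2 ⟨⟨x, h⟩, Finset.mem_univ _, rfl⟩)
  refine ⟨V ⊔ Submodule.span K {x}, Submodule.finrank_sup_span_singleton hxV,
    fun b hb hbW => ?_⟩
  obtain ⟨v, hv, y, hy, rfl⟩ := Submodule.mem_sup.1 hbW
  obtain ⟨c, rfl⟩ := Submodule.mem_span_singleton.1 hy
  have hc : c ≠ 0 := by
    rintro rfl
    exact hV _ hb (by simpa using hv)
  refine hx.1 (Finset.mem_image.2 ⟨(v + c • x, ⟨-(c⁻¹ • v), V.neg_mem (V.smul_mem _ hv)⟩,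
    (Units.mk0 c hc)⁻¹), Finset.mem_product.2 ⟨hb, Finset.mem_univ _⟩, ?_⟩)
  simp [Units.smul_def, smul_add, smul_smul, hc]

theorem mul_pow_mul_pred_add_pow_lt {q n k m : ℕ} (hq : 1 < q) (hk : k + 1 ≤ n)
    (h : m * (q ^ (k + 1) - 1) < q ^ n - 1) : m * (q ^ k * (q - 1)) + q ^ k < q ^ n := by
  obtain ⟨d, rfl⟩ := Nat.exists_eq_add_of_le hk
  have ha : 1 ≤ q ^ d := Nat.one_le_pow _ _ (by lia)
  have hc : 1 ≤ q ^ k := Nat.one_le_pow _ _ (by lia)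
  have hqc : 1 < q ^ (k + 1) := Nat.one_lt_pow (by lia) hq
  have hn : 1 ≤ q ^ (k + 1 + d) := Nat.one_le_pow _ _ (by lia)
  zify [hq.le, hqc.le, hn] at h ⊢
  rw [pow_add _ (k + 1) d, pow_succ _ k] at h
  rw [pow_add _ (k + 1) d, pow_succ _ k]
  zify at ha hc hqc hq
  rw [pow_succ _ k] at hqc
  generalize (q : ℤ) ^ d = a at *
  generalize (q : ℤ) ^ k = c at *
  generalize (q : ℤ) = q at *
  generalize (m : ℤ) = m at *
  have key : m * (q - 1) < q * a - 1 := by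
    refine lt_of_mul_lt_mul_right (a := c * q - 1) ?_ (by lia)
    have h1 : m * (c * q - 1) * (q - 1) < (c * q * a - 1) * (q - 1) :=
      mul_lt_mul_of_pos_right h (by lia)
    have h2 : 0 ≤ q * ((a - 1) * (c - 1)) :=
      mul_nonneg (by lia) (mul_nonneg (by lia) (by lia))
    linarith
  have := mul_lt_mul_of_pos_left key (show 0 < c by lia)
  linarith

/-- **Lemma 2 (subspace_lemma, general form).** Let `p` be a prime, `n ≥ 1`,
`0 ≤ k ≤ n`, and let `B` be a finite set of nonzero vectors of `𝔽_pⁿ` with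
`|B|·(p^k − 1) < pⁿ − 1`.  Then there is a `k`-dimensional `𝔽_p`-linear
subspace `V` of `𝔽_pⁿ` with `V ∩ B = ∅`. -/
theorem subspace_avoiding (p n k : ℕ) [Fact p.Prime] (hn : 1 ≤ n) (hk : k ≤ n)
    (B : Finset (Fin n → ZMod p)) (hB0 : (0 : Fin n → ZMod p) ∉ B)
    (hcard : B.card * (p ^ k - 1) < p ^ n - 1) :
    ∃ V : Submodule (ZMod p) (Fin n → ZMod p),
      Module.finrank (ZMod p) V = k ∧ ∀ b ∈ B, b ∉ V := by
  induction k with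
  | zero =>
    refine ⟨⊥, finrank_bot _ _, fun b hb hb' => ?_⟩
    exact hB0 ((Submodule.mem_bot _).1 hb' ▸ hb)
  | succ k ih =>
    have hp : 1 < p := (Fact.out : p.Prime).one_lt
    have hmono : p ^ k ≤ p ^ (k + 1) := Nat.pow_le_pow_right hp.le k.le_succ
    obtain ⟨V, hVk, hVB⟩ := ih (by lia)
      ((Nat.mul_le_mul_left _ (Nat.sub_le_sub_right hmono 1)).trans_lt hcard)
    rw [← hVk]
    refine exists_finrank_succ_avoiding B V hVB ?_
    rw [hVk, ZMod.card, Fintype.card_fun, ZMod.card, Fintype.card_fin]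
    exact mul_pow_mul_pred_add_pow_lt hp hk hcard
end

section
/- Let p be an odd prime and n ≥ 1, and let R₁ ⊆ R₂ be finite subsets of 𝔽_pⁿ with |R₁| = ℓ ≥ 1 and |R₂| ≤ Bℓ for some real B ≥ 1. Suppose that for every pair (b₁, b₂) ∈ R₁ × R₁ there exists a ≠ 0 in 𝔽_pⁿ with −2a ∈ R₂, a + b₁ ∈ R₂ and a + b₂ ∈ R₂. Then there exists t ≠ 0 in 𝔽_pⁿ such that |R₂ ∩ (R₂ + t)| ≥ (ℓ/B)^{1/2}. -/
theorem neg_two_nsmul_injective {p n : ℕ} (hp : p.Prime) (hp2 : p ≠ 2) :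
    Function.Injective fun a : Fin n → ZMod p => -(2 • a) := by
  have : Fact p.Prime := ⟨hp⟩
  have h2 : (2 : ZMod p) ≠ 0 := Ring.two_ne_zero (by rwa [ZMod.ringChar_zmod_n])
  intro a b hab
  ext i : 1
  have hi := congrFun hab i
  simpa [h2] using hi

/-- If every pair of elements of `R₁` is carried into `R₂` by a common translation in `S`,
then the squared numbers of elements carried into `R₂` by `a ∈ S` sum to at least `|R₁|²`. -/
theorem card_sq_le_sum_card_filter_sq {G : Type*} [Add G] [DecidableEq G] (R₁ R₂ S : Finset G)
    (h : ∀ b₁ ∈ R₁, ∀ b₂ ∈ R₁, ∃ a ∈ S, a + b₁ ∈ R₂ ∧ a + b₂ ∈ R₂) :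
    R₁.card ^ 2 ≤ ∑ a ∈ S, {b ∈ R₁ | a + b ∈ R₂}.card ^ 2 := by
  have hcover : R₁ ×ˢ R₁ ⊆
      S.biUnion fun a => {b ∈ R₁ | a + b ∈ R₂} ×ˢ {b ∈ R₁ | a + b ∈ R₂} := by
    rintro ⟨b₁, b₂⟩ hb
    obtain ⟨hb₁, hb₂⟩ := Finset.mem_product.1 hb
    obtain ⟨a, ha, h₁, h₂⟩ := h b₁ hb₁ b₂ hb₂
    simp only [Finset.mem_biUnion, Finset.mem_product, Finset.mem_filter]
    exact ⟨a, ha, ⟨hb₁, h₁⟩, hb₂, h₂⟩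
  simpa [Finset.card_product, sq] using (Finset.card_le_card hcover).trans Finset.card_biUnion_le

theorem card_filter_add_mem_le {G : Type*} [AddCommGroup G] [DecidableEq G] {R₁ R₂ : Finset G}
    (hsub : R₁ ⊆ R₂) (a : G) :
    {b ∈ R₁ | a + b ∈ R₂}.card ≤ (R₂ ∩ R₂.image (· + a)).card := by
  refine Finset.card_le_card_of_injOn (a + ·) (fun b hb => ?_) (add_right_injective a).injOn
  obtain ⟨hb₁, hb₂⟩ := Finset.mem_filter.1 hb
  exact Finset.mem_inter.2 ⟨hb₂, Finset.mem_image.2 ⟨b, hsub hb₁, add_comm b a⟩⟩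

/-- **Pigeonhole step in Lemma prop1.** Let `p` be an odd prime, `n ≥ 1`, and
let `R₁ ⊆ R₂` be finite subsets of `𝔽_pⁿ` with `|R₁| = ℓ ≥ 1` and `|R₂| ≤ Bℓ`
for some real `B ≥ 1`.  If for every pair `(b₁, b₂) ∈ R₁ × R₁` there is
`a ≠ 0` with `−2a ∈ R₂`, `a + b₁ ∈ R₂`, `a + b₂ ∈ R₂`, then there is `t ≠ 0`
with `|R₂ ∩ (R₂ + t)| ≥ (ℓ/B)^{1/2}`. -/
theorem pigeonhole_shift (p n : ℕ) [NeZero p] (hp : p.Prime) (hp2 : p ≠ 2) (hn : 1 ≤ n)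
    (R₁ R₂ : Finset (Fin n → ZMod p)) (hsub : R₁ ⊆ R₂)
    (ℓ : ℕ) (hcard : R₁.card = ℓ) (hℓ : 1 ≤ ℓ)
    (B : ℝ) (hB : 1 ≤ B) (hR₂ : (R₂.card : ℝ) ≤ B * ℓ)
    (hyp : ∀ b₁ ∈ R₁, ∀ b₂ ∈ R₁, ∃ a : Fin n → ZMod p, a ≠ 0 ∧
      -(2 • a) ∈ R₂ ∧ a + b₁ ∈ R₂ ∧ a + b₂ ∈ R₂) :
    ∃ t : Fin n → ZMod p, t ≠ 0 ∧
      Real.sqrt ((ℓ : ℝ) / B) ≤ ((R₂ ∩ R₂.image (· + t)).card : ℝ) := by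
  let S : Finset (Fin n → ZMod p) := {a | a ≠ 0 ∧ -(2 • a) ∈ R₂}
  have hmem : ∀ b₁ ∈ R₁, ∀ b₂ ∈ R₁, ∃ a ∈ S, a + b₁ ∈ R₂ ∧ a + b₂ ∈ R₂ := by
    intro b₁ hb₁ b₂ hb₂
    obtain ⟨a, ha, h2a, h⟩ := hyp b₁ hb₁ b₂ hb₂
    exact ⟨a, Finset.mem_filter.2 ⟨Finset.mem_univ a, ha, h2a⟩, h⟩
  have hSne : S.Nonempty := by
    obtain ⟨b, hb⟩ : R₁.Nonempty := Finset.card_pos.1 (by omega)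
    obtain ⟨a, ha, -⟩ := hmem b hb b hb
    exact ⟨a, ha⟩
  have hScard : (S.card : ℝ) ≤ B * ℓ := by
    refine le_trans (Nat.cast_le.2 ?_) hR₂
    exact Finset.card_le_card_of_injOn (fun a => -(2 • a))
      (fun a ha => (Finset.mem_filter.1 ha).2.2) (neg_two_nsmul_injective hp hp2).injOn
  have hB0 : 0 < B := by linarith
  have hsum : ∑ _a ∈ S, (ℓ : ℝ) / B ≤ ∑ a ∈ S, ({b ∈ R₁ | a + b ∈ R₂}.card : ℝ) ^ 2 := by
    calc ∑ _a ∈ S, (ℓ : ℝ) / B = S.card * (ℓ / B) := by simp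
      _ ≤ B * ℓ * (ℓ / B) := by gcongr
      _ = (R₁.card : ℝ) ^ 2 := by rw [hcard]; field_simp
      _ ≤ _ := by exact_mod_cast card_sq_le_sum_card_filter_sq R₁ R₂ S hmem
  obtain ⟨a, ha, hle⟩ := Finset.exists_le_of_sum_le hSne hsum
  refine ⟨a, (Finset.mem_filter.1 ha).2.1, Real.sqrt_le_iff.2 ⟨Nat.cast_nonneg _, hle.trans ?_⟩⟩
  exact pow_le_pow_left₀ (Nat.cast_nonneg _) (Nat.cast_le.2 (card_filter_add_mem_le hsub a)) 2
end
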